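/- Let f : {0,1}^n → {0,1} be a Boolean function. Then bs(f) ≤ C(f) ≤ max(2^{s(f)-1} · (s(f) − 1/3), s(f)). -/

import Mathlib

/-- The input `x` with its `i`-th coordinate flipped. -/
def flipCoord {n : ℕ} (x : Fin n → Bool) (i : Fin n) : Fin n → Bool :=
  Function.update x i (!(x i))

/-- The sensitivity `s(f, x)` of a Boolean function `f` on input `x`:
the number of coordinates whose flip changes the value of `f`. -/
def sensAt {n : ℕ} (f : (Fin n → Bool) → Bool) (x : Fin n → Bool) : ℕ :=
  (Finset.univ.filter fun i => f (flipCoord x i) ≠ f x).card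

/-- The `b`-sensitivity `s_b(f)`: the maximum of `s(f, x)` over inputs `x` with `f x = b`. -/
def bSens {n : ℕ} (f : (Fin n → Bool) → Bool) (b : Bool) : ℕ :=
  (Finset.univ.filter fun x => f x = b).sup (sensAt f)

/-- The certificate complexity `C(f, x)`: the minimum size of a set `P` of coordinates
such that fixing the coordinates in `P` to their values in `x` forces the value of `f`. -/
noncomputable def certAt {n : ℕ} (f : (Fin n → Bool) → Bool) (x : Fin n → Bool) : ℕ :=
  sInf {k | ∃ P : Finset (Fin n), P.card = k ∧
    ∀ y : Fin n → Bool, (∀ i ∈ P, y i = x i) → f y = f x}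

/-- The `b`-certificate complexity `C_b(f)`: the maximum of `C(f, x)` over `x` with `f x = b`. -/
noncomputable def bCert {n : ℕ} (f : (Fin n → Bool) → Bool) (b : Bool) : ℕ :=
  (Finset.univ.filter fun x => f x = b).sup (certAt f)

/-- A Boolean function is non-constant if it takes two different values. -/
def NonConstant {n : ℕ} (f : (Fin n → Bool) → Bool) : Prop :=
  ∃ x y, f x ≠ f y

/-- The input `x` with all coordinates in the block `B` flipped. -/
def flipBlock {n : ℕ} (x : Fin n → Bool) (B : Finset (Fin n)) : Fin n → Bool :=
  fun i => if i ∈ B then !(x i) else x i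

/-- The block sensitivity `bs(f, x)`: the maximum number `t` of pairwise disjoint blocks
`B₁, …, B_t` such that flipping any one of them changes the value of `f` on `x`. -/
noncomputable def bsAt {n : ℕ} (f : (Fin n → Bool) → Bool) (x : Fin n → Bool) : ℕ :=
  sSup {t | ∃ B : Fin t → Finset (Fin n),
    (∀ i j, i ≠ j → Disjoint (B i) (B j)) ∧ ∀ i, f (flipBlock x (B i)) ≠ f x}

/-- The block sensitivity `bs(f)`. -/
noncomputable def blockSens {n : ℕ} (f : (Fin n → Bool) → Bool) : ℕ :=
  Finset.univ.sup (bsAt f)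

/-- The sensitivity `s(f) = max(s₀(f), s₁(f))`. -/
def totalSens {n : ℕ} (f : (Fin n → Bool) → Bool) : ℕ :=
  max (bSens f false) (bSens f true)

/-- The certificate complexity `C(f) = max(C₀(f), C₁(f))`. -/
noncomputable def totalCert {n : ℕ} (f : (Fin n → Bool) → Bool) : ℕ :=
  max (bCert f false) (bCert f true)

theorem flipCoord_flipCoord {n : ℕ} (x : Fin n → Bool) (i : Fin n) :
    flipCoord (flipCoord x i) i = x := by
  simp [flipCoord]

theorem flipCoord_comm {n : ℕ} (x : Fin n → Bool) (i j : Fin n) :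
    flipCoord (flipCoord x i) j = flipCoord (flipCoord x j) i := by
  rcases eq_or_ne i j with rfl | h
  · rfl
  · simp [flipCoord, Function.update_of_ne h, Function.update_of_ne h.symm,
      Function.update_comm h]

theorem flipCoord_apply_self {n : ℕ} (x : Fin n → Bool) (i : Fin n) :
    flipCoord x i i = !(x i) := by
  simp [flipCoord]

theorem flipCoord_apply_of_ne {n : ℕ} (x : Fin n → Bool) {i j : Fin n} (h : j ≠ i) :
    flipCoord x i j = x j := by
  simp [flipCoord, h]

theorem flipCoord_cons_zero {n : ℕ} (b : Bool) (y : Fin n → Bool) :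
    flipCoord (Fin.cons b y : Fin (n + 1) → Bool) 0 = Fin.cons (!b) y := by
  simp [flipCoord]

theorem flipCoord_cons_succ {n : ℕ} (b : Bool) (y : Fin n → Bool) (i : Fin n) :
    flipCoord (Fin.cons b y : Fin (n + 1) → Bool) i.succ = Fin.cons b (flipCoord y i) := by
  simp [flipCoord, Fin.cons_update]

theorem piecewise_flipCoord_of_mem {n : ℕ} {P : Finset (Fin n)} {a : Fin n} (ha : a ∈ P)
    (x y : Fin n → Bool) : P.piecewise x (flipCoord y a) = P.piecewise x y := by
  ext j
  by_cases hj : j ∈ P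
  · simp [hj]
  · have : j ≠ a := fun h => hj (h ▸ ha)
    simp [hj, flipCoord_apply_of_ne _ this]

theorem piecewise_flipCoord_of_notMem {n : ℕ} {P : Finset (Fin n)} {a : Fin n} (ha : a ∉ P)
    (x y : Fin n → Bool) :
    P.piecewise x (flipCoord y a) = flipCoord (P.piecewise x y) a := by
  ext j
  rcases eq_or_ne j a with rfl | h
  · simp [ha, flipCoord_apply_self]
  · by_cases hj : j ∈ P <;> simp [hj, flipCoord_apply_of_ne _ h]

/-- The number of edges of the Boolean cube leaving the set `S` at the vertex `y`. -/
def exitDegree {n : ℕ} (S : Finset (Fin n → Bool)) (y : Fin n → Bool) : ℕ :=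
  (Finset.univ.filter fun i => flipCoord y i ∉ S).card

/-- `S` is a subcube of the Boolean cube, obtained by fixing exactly `k` coordinates. -/
def IsSubcube {n : ℕ} (S : Finset (Fin n → Bool)) (k : ℕ) : Prop :=
  ∃ (P : Finset (Fin n)) (z : Fin n → Bool), P.card = k ∧ ∀ y, y ∈ S ↔ ∀ i ∈ P, y i = z i

theorem IsSubcube.flipCoord_mem_iff {n : ℕ} {P : Finset (Fin n)} {z y : Fin n → Bool}
    (hy : ∀ i ∈ P, y i = z i) (a : Fin n) :
    (∀ i ∈ P, flipCoord y a i = z i) ↔ a ∉ P := by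
  constructor
  · intro h ha
    have h1 := h a ha
    rw [flipCoord_apply_self, hy a ha] at h1
    simp at h1
  · intro ha i hi
    rw [flipCoord_apply_of_ne y (ne_of_mem_of_not_mem hi ha), hy i hi]

theorem IsSubcube.exitDegree_eq {n k : ℕ} {S : Finset (Fin n → Bool)} (hS : IsSubcube S k)
    {y : Fin n → Bool} (hy : y ∈ S) : exitDegree S y = k := by
  obtain ⟨P, z, rfl, h⟩ := hS
  rw [exitDegree]
  congr 1
  ext a
  rw [Finset.mem_filter_univ, h, flipCoord_mem_iff ((h y).1 hy), not_not]

theorem IsSubcube.flipCoord_flipCoord_mem {n k : ℕ} {S : Finset (Fin n → Bool)}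
    (hS : IsSubcube S k) {y : Fin n → Bool} {a b : Fin n} (hy : y ∈ S)
    (ha : flipCoord y a ∈ S) (hb : flipCoord y b ∈ S) :
    flipCoord (flipCoord y a) b ∈ S := by
  obtain ⟨P, z, -, h⟩ := hS
  have hb' := (flipCoord_mem_iff ((h y).1 hy) b).1 ((h _).1 hb)
  exact (h _).2 ((flipCoord_mem_iff ((h _).1 ha) b).2 hb')

theorem IsSubcube.eq_of_flipCoord_mem {n k : ℕ} {S : Finset (Fin n → Bool)}
    (hS : IsSubcube S k) {y : Fin n → Bool} {a b : Fin n} (hy : y ∉ S)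
    (ha : flipCoord y a ∈ S) (hb : flipCoord y b ∈ S) : a = b := by
  obtain ⟨P, z, -, h⟩ := hS
  rw [h] at hy ha hb
  push Not at hy
  obtain ⟨i, hi, hne⟩ := hy
  have key : ∀ c, (∀ i ∈ P, flipCoord y c i = z i) → c = i := by
    intro c hc
    by_contra hci
    exact hne (by rw [← hc i hi, flipCoord_apply_of_ne y (Ne.symm hci)])
  rw [key a ha, key b hb]

/-- The part of `S` with first coordinate `b`, as a subset of the cube of one dimension less. -/
def cubeSlice {n : ℕ} (S : Finset (Fin (n + 1) → Bool)) (b : Bool) : Finset (Fin n → Bool) :=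
  Finset.univ.filter fun y => Fin.cons b y ∈ S

theorem mem_cubeSlice {n : ℕ} {S : Finset (Fin (n + 1) → Bool)} {b : Bool}
    {y : Fin n → Bool} : y ∈ cubeSlice S b ↔ (Fin.cons b y : Fin (n + 1) → Bool) ∈ S := by
  simp [cubeSlice]

theorem card_eq_card_cubeSlice_add {n : ℕ} (S : Finset (Fin (n + 1) → Bool)) (b : Bool) :
    S.card = (cubeSlice S b).card + (cubeSlice S (!b)).card := by
  have hinj : ∀ c : Bool, Function.Injective
      (fun y : Fin n → Bool => (Fin.cons c y : Fin (n + 1) → Bool)) :=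
    fun c => Fin.cons_right_injective (α := fun _ => Bool) c
  rw [← Finset.card_image_of_injective (cubeSlice S b) (hinj b),
    ← Finset.card_image_of_injective (cubeSlice S (!b)) (hinj (!b)),
    ← Finset.card_union_of_disjoint]
  · congr 1
    ext y
    obtain ⟨c, y, rfl⟩ : ∃ c w, y = Fin.cons c w :=
      ⟨y 0, Fin.tail y, (Fin.cons_self_tail y).symm⟩
    simp only [Finset.mem_union, Finset.mem_image, mem_cubeSlice, Fin.cons_inj]
    cases b <;> cases c <;> simp
  · rw [Finset.disjoint_left]
    intro y hy hy'
    simp only [Finset.mem_image] at hy hy'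
    obtain ⟨u, -, rfl⟩ := hy
    obtain ⟨v, -, hv⟩ := hy'
    rw [Fin.cons_inj] at hv
    simp at hv

theorem exitDegree_cons {n : ℕ} (S : Finset (Fin (n + 1) → Bool)) (b : Bool)
    (y : Fin n → Bool) :
    exitDegree S (Fin.cons b y) =
      (if y ∈ cubeSlice S (!b) then 0 else 1) + exitDegree (cubeSlice S b) y := by
  simp only [exitDegree, Fin.card_filter_univ_succ, flipCoord_cons_zero, mem_cubeSlice]
  simp only [flipCoord_cons_succ]
  split_ifs <;> simp_all [add_comm]

theorem IsSubcube.of_cubeSlice_empty {n k : ℕ} {S : Finset (Fin (n + 1) → Bool)} {b : Bool}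
    (hS : IsSubcube (cubeSlice S b) k) (he : cubeSlice S (!b) = ∅) : IsSubcube S (k + 1) := by
  obtain ⟨P, z, rfl, h⟩ := hS
  refine ⟨insert 0 (P.map (Fin.succEmb n)), Fin.cons b z, ?_, ?_⟩
  · rw [Finset.card_insert_of_notMem (by simp), Finset.card_map]
  · intro y
    obtain ⟨c, y, rfl⟩ : ∃ c w, y = Fin.cons c w :=
      ⟨y 0, Fin.tail y, (Fin.cons_self_tail y).symm⟩
    by_cases hc : c = b
    · subst hc
      rw [← mem_cubeSlice, h]
      simp
    · have hc' : c = !b := by cases b <;> cases c <;> simp_all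
      subst hc'
      rw [← mem_cubeSlice, he]
      simp

theorem IsSubcube.of_cubeSlice_eq {n k : ℕ} {S : Finset (Fin (n + 1) → Bool)} {b : Bool}
    (hS : IsSubcube (cubeSlice S b) k) (he : cubeSlice S (!b) = cubeSlice S b) :
    IsSubcube S k := by
  obtain ⟨P, z, rfl, h⟩ := hS
  refine ⟨P.map (Fin.succEmb n), Fin.cons b z, by rw [Finset.card_map], ?_⟩
  intro y
  obtain ⟨c, y, rfl⟩ : ∃ c w, y = Fin.cons c w :=
    ⟨y 0, Fin.tail y, (Fin.cons_self_tail y).symm⟩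
  have hc : cubeSlice S c = cubeSlice S b := by
    cases b <;> cases c <;> simp_all
  rw [← mem_cubeSlice, hc, h]
  simp

/-- A nonempty subset of the `n`-cube all of whose vertices have at most `k` neighbours outside
it is either a subcube of codimension `k` or has at least `3 / 2 * 2 ^ (n - k)` elements. -/
theorem card_ge_or_isSubcube {n : ℕ} : ∀ (k : ℕ) (S : Finset (Fin n → Bool)), S.Nonempty →
    (∀ y ∈ S, exitDegree S y ≤ k) →
    3 * 2 ^ n ≤ 2 * (2 ^ k * S.card) ∨ (2 ^ k * S.card = 2 ^ n ∧ IsSubcube S k) := by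
  induction n with
  | zero =>
    intro k S hS _
    have hcard : S.card = 1 := by
      refine le_antisymm ?_ hS.card_pos
      simpa using Finset.card_le_univ S
    cases k with
    | zero =>
      refine Or.inr ⟨by simp [hcard], ∅, default, rfl, fun y => ?_⟩
      obtain ⟨w, hw⟩ := hS
      simp [Subsingleton.elim y w, hw]
    | succ k =>
      left
      have := Nat.one_le_two_pow (n := k)
      rw [hcard, pow_succ]
      omega
  | succ n ih =>
    intro k S hS hdeg
    have hslice : ∀ b, ∀ y ∈ cubeSlice S b,
        (if y ∈ cubeSlice S (!b) then 0 else 1) + exitDegree (cubeSlice S b) y ≤ k := by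
      intro b y hy
      rw [← exitDegree_cons]
      exact hdeg _ (mem_cubeSlice.1 hy)
    by_cases hempty : ∃ b, cubeSlice S (!b) = ∅
    · obtain ⟨b, hb⟩ := hempty
      have hcard := card_eq_card_cubeSlice_add S b
      rw [hb, Finset.card_empty, add_zero] at hcard
      have hne : (cubeSlice S b).Nonempty := by
        rw [← Finset.card_pos, ← hcard]
        exact hS.card_pos
      have hle : ∀ y ∈ cubeSlice S b, 1 + exitDegree (cubeSlice S b) y ≤ k := by
        intro y hy
        simpa [hb] using hslice b y hy
      obtain ⟨k, rfl⟩ : ∃ l, k = l + 1 := by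
        obtain ⟨y, hy⟩ := hne
        exact ⟨k - 1, by have := hle y hy; omega⟩
      rw [hcard, pow_succ, pow_succ]
      rcases ih k _ hne (fun y hy => by have := hle y hy; omega) with h | ⟨h, hcube⟩
      · left
        linarith
      · exact Or.inr ⟨by linarith, hcube.of_cubeSlice_empty hb⟩
    · push Not at hempty
      have hne : ∀ b, (cubeSlice S b).Nonempty := fun b => by simpa using hempty (!b)
      have hdeg' : ∀ b, ∀ y ∈ cubeSlice S b, exitDegree (cubeSlice S b) y ≤ k :=
        fun b y hy => by have := hslice b y hy; omega
      by_cases hlight : ∃ b, 2 ^ k * (cubeSlice S b).card = 2 ^ n ∧ IsSubcube (cubeSlice S b) k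
      · obtain ⟨b, hcard, hcube⟩ := hlight
        have hsub : cubeSlice S b ⊆ cubeSlice S (!b) := by
          intro y hy
          have h := hslice b y hy
          rw [hcube.exitDegree_eq hy] at h
          by_contra hy'
          simp only [hy', if_false] at h
          omega
        have htotal := card_eq_card_cubeSlice_add S b
        have hsdiff := Finset.card_sdiff_add_card_eq_card hsub
        rcases (cubeSlice S (!b) \ cubeSlice S b).eq_empty_or_nonempty with h0 | h0
        · right
          have heq : cubeSlice S (!b) = cubeSlice S b :=
            Finset.Subset.antisymm (Finset.sdiff_eq_empty_iff_subset.1 h0) hsub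
          refine ⟨?_, hcube.of_cubeSlice_eq heq⟩
          rw [htotal, heq, mul_add, hcard, pow_succ]
          ring
        · left
          have hC : ∀ y ∈ cubeSlice S (!b) \ cubeSlice S b,
              exitDegree (cubeSlice S (!b) \ cubeSlice S b) y ≤ k := by
            intro y hy
            rw [Finset.mem_sdiff] at hy
            have h := hslice (!b) y hy.1
            rw [Bool.not_not, if_neg hy.2] at h
            have hone : (Finset.univ.filter fun i => flipCoord y i ∈ cubeSlice S b).card ≤ 1 := by
              rw [Finset.card_le_one]
              intro i hi j hj
              rw [Finset.mem_filter_univ] at hi hj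
              exact hcube.eq_of_flipCoord_mem hy.2 hi hj
            have hunion : exitDegree (cubeSlice S (!b) \ cubeSlice S b) y ≤
                (Finset.univ.filter fun i => flipCoord y i ∈ cubeSlice S b).card +
                  exitDegree (cubeSlice S (!b)) y := by
              refine le_trans (Finset.card_le_card ?_) (Finset.card_union_le _ _)
              intro i hi
              simp only [Finset.mem_union, Finset.mem_filter_univ, Finset.mem_sdiff] at hi ⊢
              tauto
            omega
          have hcard' : 2 ^ n ≤ 2 ^ k * (cubeSlice S (!b) \ cubeSlice S b).card := by
            rcases ih k _ h0 hC with h | ⟨h, -⟩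
            · omega
            · exact h.ge
          have hexpand : 2 ^ k * S.card = 2 ^ k * (cubeSlice S b).card +
              (2 ^ k * (cubeSlice S (!b) \ cubeSlice S b).card +
                2 ^ k * (cubeSlice S b).card) := by
            rw [htotal, ← hsdiff]
            ring
          rw [hexpand, hcard, pow_succ]
          omega
      · left
        push Not at hlight
        have hheavy : ∀ b, 3 * 2 ^ n ≤ 2 * (2 ^ k * (cubeSlice S b).card) := by
          intro b
          rcases ih k _ (hne b) (hdeg' b) with h | ⟨h, h'⟩
          · exact h
          · exact absurd h' (hlight b h)
        have h0 := hheavy true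
        have h1 := hheavy (!true)
        rw [card_eq_card_cubeSlice_add S true, mul_add, pow_succ]
        omega

/-- If `U` has no square of the cube with exactly three vertices in `U`, and every vertex of `U`
has a neighbour outside `U`, then at least `|U|` vertices outside `U` have a neighbour in `U`. -/
theorem exists_boundary_card_eq {n : ℕ} (U : Finset (Fin n → Bool))
    (hleave : ∀ y ∈ U, ∃ a, flipCoord y a ∉ U)
    (hsq : ∀ y ∈ U, ∀ a b, flipCoord y a ∈ U → flipCoord y b ∈ U →
      flipCoord (flipCoord y a) b ∈ U) :
    ∃ V : Finset (Fin n → Bool), V.card = U.card ∧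
      ∀ v ∈ V, v ∉ U ∧ ∃ a, flipCoord v a ∈ U := by
  rcases U.eq_empty_or_nonempty with rfl | ⟨y₀, hy₀⟩
  · exact ⟨∅, rfl, by simp⟩
  have : Nonempty (Fin n) := (hleave y₀ hy₀).nonempty
  have hmax : ∀ y ∈ U, ∃ a, flipCoord y a ∉ U ∧ ∀ b, a < b → flipCoord y b ∈ U := by
    intro y hy
    obtain ⟨a, ha⟩ := hleave y hy
    obtain ⟨c, hc, hcmax⟩ := (Finset.univ.filter fun a => flipCoord y a ∉ U).exists_max_image id
      ⟨a, by simpa using ha⟩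
    refine ⟨c, by simpa using hc, fun b hb => ?_⟩
    by_contra hbU
    exact absurd (hcmax b (by simpa using hbU)) (not_le.2 hb)
  choose! d hd hdmax using hmax
  have hlt : ∀ y ∈ U, ∀ w ∈ U, flipCoord y (d y) = flipCoord w (d w) → ¬ d y < d w := by
    intro y hy w hw heq hlt
    have hyb := hdmax y hy _ hlt
    have hw' : flipCoord (flipCoord y (d w)) (d y) = w := by
      rw [flipCoord_comm, heq, flipCoord_flipCoord]
    have := hsq _ hyb (d y) (d w) (by rwa [hw']) (by rwa [flipCoord_flipCoord])
    rw [hw'] at this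
    exact hd w hw this
  refine ⟨U.image fun y => flipCoord y (d y), Finset.card_image_of_injOn ?_, ?_⟩
  · intro y hy w hw heq
    have hdeq : d y = d w :=
      le_antisymm (not_lt.1 (hlt w hw y hy heq.symm)) (not_lt.1 (hlt y hy w hw heq))
    simp only at heq
    rw [← flipCoord_flipCoord y (d y), heq, hdeq, flipCoord_flipCoord]
  · intro v hv
    obtain ⟨y, hy, rfl⟩ := Finset.mem_image.1 hv
    exact ⟨hd y hy, d y, by rwa [flipCoord_flipCoord]⟩

theorem sum_card_filter_mem {α ι : Type*} [Fintype α] [DecidableEq α] (P : Finset ι)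
    (T : ι → Finset α) :
    ∑ y, (P.filter fun i => y ∈ T i).card = ∑ i ∈ P, (T i).card := by
  simpa [Finset.bipartiteAbove, Finset.bipartiteBelow] using
    (Finset.sum_card_bipartiteAbove_eq_sum_card_bipartiteBelow (s := P) (t := Finset.univ)
      (fun i y => y ∈ T i)).symm

/-- The weighted count for a family of sets `T i`, `i ∈ P`, covering each vertex of the cube at
most `s` times, where the sets indexed by `L ⊆ P` are closed under completing squares, and no set
of the family is adjacent to a vertex outside it covered `s` times by the sets indexed by `L`. -/
theorem two_mul_sum_card_add_sum_card_le {n s : ℕ} {ι : Type*} (P L : Finset ι)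
    (T : ι → Finset (Fin n → Bool)) (hLP : L ⊆ P) (hs : 1 ≤ s)
    (hcover : ∀ y, (P.filter fun i => y ∈ T i).card ≤ s)
    (hfar : ∀ y, (L.filter fun i => y ∈ T i).card = s →
      ∀ i ∈ P, y ∉ T i → ∀ a, flipCoord y a ∉ T i)
    (hleave : ∀ i ∈ L, ∀ y ∈ T i, ∃ a, flipCoord y a ∉ T i)
    (hsq : ∀ i ∈ L, ∀ y ∈ T i, ∀ a b, flipCoord y a ∈ T i → flipCoord y b ∈ T i →
      flipCoord (flipCoord y a) b ∈ T i) :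
    2 * ∑ i ∈ P, (T i).card + ∑ i ∈ L, (T i).card + 2 ^ n ≤ 3 * s * 2 ^ n := by
  set U : Finset (Fin n → Bool) :=
    Finset.univ.filter fun y => (L.filter fun i => y ∈ T i).card = s with hU
  have memU : ∀ y, y ∈ U ↔ (L.filter fun i => y ∈ T i).card = s := by simp [hU]
  have hsub : ∀ y, (L.filter fun i => y ∈ T i) ⊆ P.filter fun i => y ∈ T i :=
    fun y => Finset.filter_subset_filter _ hLP
  have hLle : ∀ y, (L.filter fun i => y ∈ T i).card ≤ s :=
    fun y => (Finset.card_le_card (hsub y)).trans (hcover y)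
  have hback : ∀ y a i, i ∈ P → flipCoord y a ∈ U → y ∈ T i → flipCoord y a ∈ T i := by
    intro y a i hi hya hy
    by_contra hn
    exact hfar _ ((memU _).1 hya) i hi hn a (by rwa [flipCoord_flipCoord])
  obtain ⟨V, hVcard, hV⟩ := exists_boundary_card_eq U
    (by
      intro y hy
      obtain ⟨i, hi⟩ : (L.filter fun i => y ∈ T i).Nonempty := by
        rw [← Finset.card_pos, (memU y).1 hy]
        exact hs
      rw [Finset.mem_filter] at hi
      obtain ⟨a, ha⟩ := hleave i hi.1 y hi.2
      exact ⟨a, fun haU => ha (hback y a i (hLP hi.1) haU hi.2)⟩)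
    (by
      intro y hy a b ha hb
      rw [memU]
      refine le_antisymm (hLle _) ?_
      rw [← (memU y).1 hy]
      refine Finset.card_le_card fun i hi => ?_
      rw [Finset.mem_filter] at hi ⊢
      exact ⟨hi.1, hsq i hi.1 y hi.2 a b (hback y a i (hLP hi.1) ha hi.2)
        (hback y b i (hLP hi.1) hb hi.2)⟩)
  have hVcover : ∀ v ∈ V, (P.filter fun i => v ∈ T i).card < s := by
    intro v hv
    obtain ⟨hvU, a, haU⟩ := hV v hv
    refine lt_of_le_of_ne (hcover v) fun hvs => hvU ?_
    have hLP' := Finset.eq_of_subset_of_card_le (hsub (flipCoord v a))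
      ((hcover _).trans ((memU _).1 haU).ge)
    rw [memU]
    refine le_antisymm (hLle v) (hvs ▸ Finset.card_le_card fun i hi => ?_)
    rw [Finset.mem_filter] at hi
    have hmem : i ∈ P.filter fun i => flipCoord v a ∈ T i :=
      Finset.mem_filter.2 ⟨hi.1, hback v a i hi.1 haU hi.2⟩
    rw [← hLP', Finset.mem_filter] at hmem
    exact Finset.mem_filter.2 ⟨hmem.1, hi.2⟩
  have hpoint : ∀ y, 2 * (P.filter fun i => y ∈ T i).card + (L.filter fun i => y ∈ T i).card +
      1 + 2 * (if y ∈ V then 1 else 0) ≤ 3 * s + (if y ∈ U then 1 else 0) := by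
    intro y
    have h1 := hcover y
    have h2 := hLle y
    by_cases hyV : y ∈ V
    · have h3 := hVcover y hyV
      have h4 := Finset.card_le_card (hsub y)
      simp only [hyV, (hV y hyV).1, if_true, if_false]
      omega
    · by_cases hyU : y ∈ U
      · simp only [hyV, hyU, if_true, if_false]
        omega
      · have h3 : (L.filter fun i => y ∈ T i).card ≠ s := fun h => hyU ((memU y).2 h)
        simp only [hyV, hyU, if_false]
        omega
  have hsum := Finset.sum_le_sum fun y (_ : y ∈ Finset.univ) => hpoint y
  simp only [Finset.sum_add_distrib, ← Finset.mul_sum, sum_card_filter_mem, Finset.sum_const,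
    Finset.sum_boole, Finset.filter_univ_mem, Finset.card_univ, Fintype.card_fun,
    Fintype.card_bool, Fintype.card_fin, smul_eq_mul, mul_one, Nat.cast_id, hVcard] at hsum
  linarith

theorem card_le_of_forall_flipCoord_ne {n s : ℕ} {f : (Fin n → Bool) → Bool} {y : Fin n → Bool}
    (hs : sensAt f y ≤ s) {A : Finset (Fin n)} (hA : ∀ a ∈ A, f (flipCoord y a) ≠ f y) :
    A.card ≤ s :=
  (Finset.card_le_card fun a ha => by simpa using hA a ha).trans hs

/-- The vertices `y` such that `f` differs from `f x` at the point obtained from `y` by resetting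
the coordinates in `P` to their values in `x` and then flipping the coordinate `i`. -/
def neighborSupport {n : ℕ} (f : (Fin n → Bool) → Bool) (P : Finset (Fin n)) (x : Fin n → Bool)
    (i : Fin n) : Finset (Fin n → Bool) :=
  Finset.univ.filter fun y => f (flipCoord (P.piecewise x y) i) ≠ f x

theorem mem_neighborSupport {n : ℕ} {f : (Fin n → Bool) → Bool} {P : Finset (Fin n)}
    {x y : Fin n → Bool} {i : Fin n} :
    y ∈ neighborSupport f P x i ↔ f (flipCoord (P.piecewise x y) i) ≠ f x := by
  simp [neighborSupport]

section Certificate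

variable {n s : ℕ} {f : (Fin n → Bool) → Bool} {P : Finset (Fin n)} {x : Fin n → Bool}

theorem flipCoord_mem_neighborSupport_of_mem {y : Fin n → Bool} {a i : Fin n} (ha : a ∈ P) :
    flipCoord y a ∈ neighborSupport f P x i ↔ y ∈ neighborSupport f P x i := by
  rw [mem_neighborSupport, mem_neighborSupport, piecewise_flipCoord_of_mem ha]

theorem flipCoord_mem_neighborSupport_of_notMem {y : Fin n → Bool} {a i : Fin n} (ha : a ∉ P) :
    flipCoord y a ∈ neighborSupport f P x i ↔
      f (flipCoord (flipCoord (P.piecewise x y) i) a) ≠ f x := by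
  rw [mem_neighborSupport, piecewise_flipCoord_of_notMem ha, flipCoord_comm]

theorem piecewise_eq_of_certificate (hP : ∀ y : Fin n → Bool, (∀ i ∈ P, y i = x i) → f y = f x)
    (y : Fin n → Bool) : f (P.piecewise x y) = f x :=
  hP _ fun i hi => by simp [hi]

theorem notMem_of_exit {y : Fin n → Bool} {a i : Fin n} (hy : y ∈ neighborSupport f P x i)
    (ha : flipCoord y a ∉ neighborSupport f P x i) : a ∉ P :=
  fun h => ha ((flipCoord_mem_neighborSupport_of_mem h).2 hy)

theorem card_insert_exit (hP : ∀ y : Fin n → Bool, (∀ i ∈ P, y i = x i) → f y = f x)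
    {y : Fin n → Bool} {i : Fin n} (hi : i ∈ P) (hy : y ∈ neighborSupport f P x i) :
    exitDegree (neighborSupport f P x i) y + 1 =
      (insert i (Finset.univ.filter fun a => flipCoord y a ∉ neighborSupport f P x i)).card ∧
    ∀ a ∈ insert i (Finset.univ.filter fun a => flipCoord y a ∉ neighborSupport f P x i),
      f (flipCoord (flipCoord (P.piecewise x y) i) a) ≠ f (flipCoord (P.piecewise x y) i) := by
  constructor
  · rw [Finset.card_insert_of_notMem, exitDegree]
    rw [Finset.mem_filter_univ]
    exact fun h => notMem_of_exit hy h hi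
  · intro a ha
    have hy' := mem_neighborSupport.1 hy
    rcases Finset.mem_insert.1 ha with rfl | ha
    · rw [flipCoord_flipCoord, piecewise_eq_of_certificate hP]
      exact hy'.symm
    · rw [Finset.mem_filter_univ] at ha
      have haP := notMem_of_exit hy ha
      rw [flipCoord_mem_neighborSupport_of_notMem haP, not_not] at ha
      rw [ha]
      exact hy'.symm

theorem exitDegree_add_one_le (hs : ∀ y, sensAt f y ≤ s)
    (hP : ∀ y : Fin n → Bool, (∀ i ∈ P, y i = x i) → f y = f x)
    {y : Fin n → Bool} {i : Fin n} (hi : i ∈ P) (hy : y ∈ neighborSupport f P x i) :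
    exitDegree (neighborSupport f P x i) y + 1 ≤ s := by
  obtain ⟨hcard, hsens⟩ := card_insert_exit hP hi hy
  rw [hcard]
  exact card_le_of_forall_flipCoord_ne (hs _) hsens

theorem flipCoord_flipCoord_ne_of_exitDegree_eq (hs : ∀ y, sensAt f y ≤ s)
    (hP : ∀ y : Fin n → Bool, (∀ i ∈ P, y i = x i) → f y = f x)
    {y : Fin n → Bool} {i j : Fin n} (hi : i ∈ P) (hy : y ∈ neighborSupport f P x i)
    (hdeg : exitDegree (neighborSupport f P x i) y + 1 = s) (hj : j ∈ P) (hij : j ≠ i) :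
    f (flipCoord (flipCoord (P.piecewise x y) i) j) ≠ f x := by
  obtain ⟨hcard, hsens⟩ := card_insert_exit hP hi hy
  intro hjx
  have hnot : j ∉ insert i
      (Finset.univ.filter fun a => flipCoord y a ∉ neighborSupport f P x i) := by
    rw [Finset.mem_insert, Finset.mem_filter_univ, not_or]
    exact ⟨hij, fun h => notMem_of_exit hy h hj⟩
  have hle : (insert j (insert i
      (Finset.univ.filter fun a => flipCoord y a ∉ neighborSupport f P x i))).card ≤ s := by
    refine card_le_of_forall_flipCoord_ne (hs (flipCoord (P.piecewise x y) i)) fun a ha => ?_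
    rcases Finset.mem_insert.1 ha with rfl | ha
    · rw [hjx]
      exact (mem_neighborSupport.1 hy).symm
    · exact hsens a ha
  rw [Finset.card_insert_of_notMem hnot, ← hcard] at hle
  omega

theorem card_filter_mem_neighborSupport_le (hs : ∀ y, sensAt f y ≤ s)
    (hP : ∀ y : Fin n → Bool, (∀ i ∈ P, y i = x i) → f y = f x) (y : Fin n → Bool) :
    (P.filter fun i => y ∈ neighborSupport f P x i).card ≤ s := by
  refine card_le_of_forall_flipCoord_ne (hs (P.piecewise x y)) fun i hi => ?_
  rw [piecewise_eq_of_certificate hP]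
  exact mem_neighborSupport.1 (Finset.mem_filter.1 hi).2

/-- Sets of the family that have the largest possible exit degrees everywhere and contain `y`
contribute to the sensitivity at each neighbour of `y` across a coordinate of the certificate. -/
theorem flipCoord_notMem_neighborSupport (hs : ∀ y, sensAt f y ≤ s)
    (hP : ∀ y : Fin n → Bool, (∀ i ∈ P, y i = x i) → f y = f x)
    {L : Finset (Fin n)} (hLP : L ⊆ P)
    (hL : ∀ j ∈ L, ∀ y ∈ neighborSupport f P x j,
      exitDegree (neighborSupport f P x j) y + 1 = s)
    {y : Fin n → Bool} (hy : (L.filter fun j => y ∈ neighborSupport f P x j).card = s)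
    {i : Fin n} (hi : i ∈ P) (hyi : y ∉ neighborSupport f P x i) (a : Fin n) :
    flipCoord y a ∉ neighborSupport f P x i := by
  intro ha
  have haP : a ∉ P := fun h => hyi ((flipCoord_mem_neighborSupport_of_mem h).1 ha)
  have hfi : f (flipCoord (P.piecewise x y) i) = f x := by
    rwa [mem_neighborSupport, not_not] at hyi
  have hle : (insert a (L.filter fun j => y ∈ neighborSupport f P x j)).card ≤ s := by
    refine card_le_of_forall_flipCoord_ne (hs (flipCoord (P.piecewise x y) i)) fun j hj => ?_
    rw [hfi]
    rcases Finset.mem_insert.1 hj with rfl | hj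
    · exact (flipCoord_mem_neighborSupport_of_notMem haP).1 ha
    · obtain ⟨hjL, hyj⟩ := Finset.mem_filter.1 hj
      rw [flipCoord_comm]
      exact flipCoord_flipCoord_ne_of_exitDegree_eq hs hP (hLP hjL) hyj (hL j hjL y hyj) hi
        (fun h => hyi (h ▸ hyj))
  rw [Finset.card_insert_of_notMem (fun h => haP (hLP (Finset.mem_filter.1 h).1)), hy] at hle
  omega

/-- If no proper subset of the certificate `P` is a certificate, then `P` is small. -/
theorem card_certificate_le (hs : ∀ y, sensAt f y ≤ s)
    (hP : ∀ y : Fin n → Bool, (∀ i ∈ P, y i = x i) → f y = f x)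
    (hne : ∀ i ∈ P, (neighborSupport f P x i).Nonempty) :
    P.card ≤ s ∨ 3 * P.card + 2 ^ (s - 1) ≤ 2 ^ (s - 1) * (3 * s) := by
  rcases P.eq_empty_or_nonempty with rfl | ⟨i₀, hi₀⟩
  · simp
  obtain ⟨k, rfl⟩ : ∃ k, s = k + 1 := by
    obtain ⟨y, hy⟩ := hne i₀ hi₀
    exact ⟨s - 1, by have := exitDegree_add_one_le hs hP hi₀ hy; omega⟩
  have hdich : ∀ i ∈ P, _ := fun i hi => card_ge_or_isSubcube k (neighborSupport f P x i)
    (hne i hi) fun y hy => Nat.le_of_succ_le_succ (exitDegree_add_one_le hs hP hi hy)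
  have hN : 0 < 2 ^ n := by positivity
  rcases Nat.eq_zero_or_pos k with rfl | hk
  · left
    have hsum : ∑ y : Fin n → Bool, (P.filter fun i => y ∈ neighborSupport f P x i).card ≤
        ∑ y : Fin n → Bool, 1 :=
      Finset.sum_le_sum fun y _ => card_filter_mem_neighborSupport_le hs hP y
    have hlow : ∑ i ∈ P, 2 ^ n ≤ ∑ i ∈ P, (neighborSupport f P x i).card :=
      Finset.sum_le_sum fun i hi => by
        rcases hdich i hi with h | ⟨h, -⟩ <;> omega
    rw [sum_card_filter_mem] at hsum
    have h := hlow.trans hsum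
    simp only [Finset.sum_const, Finset.card_univ, Fintype.card_fun, Fintype.card_bool,
      Fintype.card_fin, smul_eq_mul, mul_one] at h
    nlinarith
  · right
    classical
    set L := P.filter fun i => IsSubcube (neighborSupport f P x i) k with hLdef
    have hLP : L ⊆ P := Finset.filter_subset _ _
    have hcube : ∀ i ∈ L, IsSubcube (neighborSupport f P x i) k :=
      fun i hi => (Finset.mem_filter.1 hi).2
    have hcount := two_mul_sum_card_add_sum_card_le P L (neighborSupport f P x) hLP
      (Nat.succ_pos k) (card_filter_mem_neighborSupport_le hs hP)
      (fun y hy i hi hyi a => flipCoord_notMem_neighborSupport hs hP hLP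
        (fun j hj y hy => by rw [(hcube j hj).exitDegree_eq hy]) hy hi hyi a)
      (fun i hi y hy => by
        have h := (hcube i hi).exitDegree_eq hy
        rw [exitDegree] at h
        obtain ⟨a, ha⟩ := Finset.card_pos.1 (h ▸ hk)
        exact ⟨a, by simpa using ha⟩)
      (fun i hi y hy a b ha hb => (hcube i hi).flipCoord_flipCoord_mem hy ha hb)
    have hlow : ∑ i ∈ P, 3 * 2 ^ n ≤ ∑ i ∈ P, 2 ^ k * (2 * (neighborSupport f P x i).card +
        if IsSubcube (neighborSupport f P x i) k then (neighborSupport f P x i).card else 0) := by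
      refine Finset.sum_le_sum fun i hi => ?_
      rcases hdich i hi with h | ⟨h, hc⟩
      · refine h.trans ?_
        rw [mul_left_comm]
        exact Nat.mul_le_mul_left _ (Nat.le_add_right _ _)
      · rw [if_pos hc]
        linarith
    rw [Finset.sum_const, smul_eq_mul, ← Finset.mul_sum, Finset.sum_add_distrib,
      ← Finset.mul_sum, ← Finset.sum_filter, ← hLdef] at hlow
    have h := Nat.mul_le_mul_left (2 ^ k) hcount
    refine Nat.le_of_mul_le_mul_right ?_ hN
    rw [Nat.add_sub_cancel]
    linarith

end Certificate

theorem exists_certificate {n : ℕ} (f : (Fin n → Bool) → Bool) (x : Fin n → Bool) :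
    ∃ P : Finset (Fin n), P.card = certAt f x ∧
      ∀ y : Fin n → Bool, (∀ i ∈ P, y i = x i) → f y = f x := by
  have hne : {k | ∃ P : Finset (Fin n), P.card = k ∧
      ∀ y : Fin n → Bool, (∀ i ∈ P, y i = x i) → f y = f x}.Nonempty :=
    ⟨_, Finset.univ, rfl, fun y hy => by rw [funext fun i => hy i (Finset.mem_univ i)]⟩
  exact Nat.sInf_mem hne

theorem certAt_le {n : ℕ} {f : (Fin n → Bool) → Bool} {x : Fin n → Bool} {P : Finset (Fin n)}
    (hP : ∀ y : Fin n → Bool, (∀ i ∈ P, y i = x i) → f y = f x) : certAt f x ≤ P.card :=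
  Nat.sInf_le ⟨P, rfl, hP⟩

theorem neighborSupport_nonempty {n : ℕ} {f : (Fin n → Bool) → Bool} {P : Finset (Fin n)}
    {x : Fin n → Bool} (hcard : P.card = certAt f x)
    (hP : ∀ y : Fin n → Bool, (∀ i ∈ P, y i = x i) → f y = f x) {i : Fin n} (hi : i ∈ P) :
    (neighborSupport f P x i).Nonempty := by
  have hnot : ¬ ∀ y : Fin n → Bool, (∀ j ∈ P.erase i, y j = x j) → f y = f x := by
    intro h
    have h1 := certAt_le h
    rw [← hcard] at h1
    exact absurd h1 (not_le.2 (Finset.card_erase_lt_of_mem hi))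
  push Not at hnot
  obtain ⟨y, hy, hfy⟩ := hnot
  have hyi : y i ≠ x i := by
    intro h
    refine hfy (hP y fun j hj => ?_)
    rcases eq_or_ne j i with rfl | hji
    · exact h
    · exact hy j (Finset.mem_erase.2 ⟨hji, hj⟩)
  refine ⟨y, mem_neighborSupport.2 ?_⟩
  have heq : flipCoord (P.piecewise x y) i = y := by
    ext j
    rcases eq_or_ne j i with rfl | hji
    · rw [flipCoord_apply_self, Finset.piecewise_eq_of_mem _ _ _ hi]
      cases hxj : x j <;> cases hyj : y j <;> simp_all
    · rw [flipCoord_apply_of_ne _ hji]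
      by_cases hj : j ∈ P
      · rw [Finset.piecewise_eq_of_mem _ _ _ hj, hy j (Finset.mem_erase.2 ⟨hji, hj⟩)]
      · rw [Finset.piecewise_eq_of_notMem _ _ _ hj]
  rwa [heq]

theorem sensAt_le_totalSens {n : ℕ} (f : (Fin n → Bool) → Bool) (x : Fin n → Bool) :
    sensAt f x ≤ totalSens f := by
  have h : sensAt f x ≤ bSens f (f x) := Finset.le_sup (f := sensAt f) (by simp)
  cases hx : f x <;> rw [hx] at h
  · exact h.trans (le_max_left _ _)
  · exact h.trans (le_max_right _ _)

theorem certAt_le_totalCert {n : ℕ} (f : (Fin n → Bool) → Bool) (x : Fin n → Bool) :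
    certAt f x ≤ totalCert f := by
  have h : certAt f x ≤ bCert f (f x) := Finset.le_sup (f := certAt f) (by simp)
  cases hx : f x <;> rw [hx] at h
  · exact h.trans (le_max_left _ _)
  · exact h.trans (le_max_right _ _)

theorem totalCert_le {n m : ℕ} {f : (Fin n → Bool) → Bool} (h : ∀ x, certAt f x ≤ m) :
    totalCert f ≤ m :=
  max_le (Finset.sup_le fun x _ => h x) (Finset.sup_le fun x _ => h x)

theorem bsAt_le_certAt {n : ℕ} (f : (Fin n → Bool) → Bool) (x : Fin n → Bool) :
    bsAt f x ≤ certAt f x := by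
  obtain ⟨P, hcard, hP⟩ := exists_certificate f x
  refine csSup_le' ?_
  rintro t ⟨B, hdisj, hB⟩
  have hmeet : ∀ i, ∃ j ∈ P, j ∈ B i := by
    intro i
    by_contra! h
    exact hB i (hP _ fun j hj => by simp [flipBlock, h j hj])
  choose g hgP hgB using hmeet
  have hinj : Function.Injective g := by
    intro i j hij
    by_contra hne
    exact Finset.disjoint_left.1 (hdisj i j hne) (hgB i) (hij ▸ hgB j)
  rw [← hcard]
  simpa using Finset.card_le_card_of_injOn (s := Finset.univ) g (fun i _ => hgP i) hinj.injOn

theorem certAt_le_or {n : ℕ} (f : (Fin n → Bool) → Bool) (x : Fin n → Bool) :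
    certAt f x ≤ totalSens f ∨
      3 * certAt f x + 2 ^ (totalSens f - 1) ≤ 2 ^ (totalSens f - 1) * (3 * totalSens f) := by
  obtain ⟨P, hcard, hP⟩ := exists_certificate f x
  rw [← hcard]
  exact card_certificate_le (sensAt_le_totalSens f) hP
    fun i hi => neighborSupport_nonempty hcard hP hi

theorem exists_certAt_eq_totalCert {n : ℕ} (f : (Fin n → Bool) → Bool) :
    ∃ x, certAt f x = totalCert f := by
  obtain ⟨x, -, hx⟩ := Finset.exists_max_image Finset.univ (certAt f) ⟨default, by simp⟩
  exact ⟨x, le_antisymm (certAt_le_totalCert f x) (totalCert_le fun y => hx y (by simp))⟩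

/-- **Corollary 2.** For every Boolean function `f`,
`bs(f) ≤ C(f) ≤ max(2^(s(f)-1) · (s(f) - 1/3), s(f))`. -/
theorem blockSens_le_cert_le {n : ℕ} (f : (Fin n → Bool) → Bool) :
    blockSens f ≤ totalCert f ∧
    (totalCert f : ℚ) ≤
      max (2 ^ (totalSens f - 1) * ((totalSens f : ℚ) - 1 / 3)) (totalSens f : ℚ) := by
  refine ⟨Finset.sup_le fun x _ => (bsAt_le_certAt f x).trans (certAt_le_totalCert f x), ?_⟩
  obtain ⟨x, hx⟩ := exists_certAt_eq_totalCert f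
  rcases certAt_le_or f x with h | h <;> rw [hx] at h
  · exact le_max_of_le_right (by exact_mod_cast h)
  · have h' : (3 * totalCert f + 2 ^ (totalSens f - 1) : ℚ) ≤
        2 ^ (totalSens f - 1) * (3 * totalSens f) := by exact_mod_cast h
    exact le_max_of_le_left (by linarith)
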